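/- The map γ̂: P*V → T*V defined on the n-th component by γ̂(x_1∧...∧x_{n-1}⊗x_n) = Σ_{σ∈S_{n-1}} ε(σ) x_{σ(1)}⊗...⊗x_{σ(n-1)}⊗x_n is an injective coalgebra morphism, and moreover γ̂∘β̂ = α̂, where α̂ and β̂ are the coalgebra maps ∧*V → T*V and ∧*V → P*V given by symmetrization and by summing over Sh(n-1,1)-unshuffles respectively. -/

import Mathlib

open scoped TensorProduct

/-- The Koszul sign `ε(σ; x_1, …, x_n)` for homogeneous elements of degrees `d`. -/
def koszulSign {n : ℕ} (d : Fin n → ℤ) (σ : Equiv.Perm (Fin n)) : ℤ :=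
  ∏ p ∈ Finset.univ.filter (fun p : Fin n × Fin n => p.1 < p.2 ∧ σ p.2 < σ p.1),
    (-1 : ℤ) ^ ((d (σ p.1)).natAbs * (d (σ p.2)).natAbs)

/-- Reindex the first `n-1` entries of an `n`-tuple by `σ ∈ S_{n-1}`, fixing the last. -/
def permExt {A : Type*} {n : ℕ} (σ : Equiv.Perm (Fin (n - 1))) (d : Fin n → A) : Fin n → A :=
  fun t => if h : t.val < n - 1 then d (Fin.castLE (Nat.sub_le n 1) (σ ⟨t.val, h⟩)) else d t

/-- Swapping the two entries of the pair if needed. -/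
theorem koszul_prod_pairs {n : ℕ} (g : Fin n → Fin n → ℤ) (hg : ∀ i j, g i j = g j i)
    (τ : Equiv.Perm (Fin n)) :
    ∏ p ∈ Finset.univ.filter (fun p : Fin n × Fin n => p.1 < p.2), g (τ p.1) (τ p.2) =
    ∏ p ∈ Finset.univ.filter (fun p : Fin n × Fin n => p.1 < p.2), g p.1 p.2 := by
  refine Finset.prod_bij'
    (fun p _ => if τ p.1 < τ p.2 then (τ p.1, τ p.2) else (τ p.2, τ p.1))
    (fun p _ => if τ.symm p.1 < τ.symm p.2 then (τ.symm p.1, τ.symm p.2)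
      else (τ.symm p.2, τ.symm p.1)) ?_ ?_ ?_ ?_ ?_
  · rintro ⟨a, b⟩ h
    have h1 : a < b := by simpa using h
    have h2 : τ a ≠ τ b := fun h => h1.ne (τ.injective h)
    by_cases h3 : τ a < τ b
    · simp [h3]
    · simpa [h3] using lt_of_le_of_ne (not_lt.1 h3) h2.symm
  · rintro ⟨a, b⟩ h
    have h1 : a < b := by simpa using h
    have h2 : τ.symm a ≠ τ.symm b := fun h => h1.ne (τ.symm.injective h)
    by_cases h3 : τ.symm a < τ.symm b
    · simp [h3]
    · simpa [h3] using lt_of_le_of_ne (not_lt.1 h3) h2.symm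
  · rintro ⟨a, b⟩ h
    have h1 : a < b := by simpa using h
    by_cases h3 : τ a < τ b
    · simp [h3, h1]
    · simp [h3, h1.le]
  · rintro ⟨a, b⟩ h
    have h1 : a < b := by simpa using h
    by_cases h3 : τ.symm a < τ.symm b
    · simp [h3, h1]
    · simp [h3, h1.le]
  · rintro ⟨a, b⟩ h
    by_cases h3 : τ a < τ b
    · simp [h3]
    · simp [h3, hg (τ a)]

theorem koszulSign_eq {n : ℕ} (d : Fin n → ℤ) (σ : Equiv.Perm (Fin n)) :
    koszulSign d σ = ∏ p ∈ Finset.univ.filter (fun p : Fin n × Fin n => p.1 < p.2),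
      if (p.1 < p.2 ↔ σ p.1 < σ p.2) then 1 else
        (-1 : ℤ) ^ ((d (σ p.1)).natAbs * (d (σ p.2)).natAbs) := by
  unfold koszulSign
  rw [← Finset.filter_filter, Finset.prod_filter]
  refine Finset.prod_congr rfl ?_
  rintro ⟨a, b⟩ h
  have h1 : a < b := by simpa using h
  have h2 : σ a ≠ σ b := fun h => h1.ne (σ.injective h)
  by_cases h3 : σ a < σ b
  · simp [h1, h3, h3.le]
  · have : σ b < σ a := lt_of_le_of_ne (not_lt.1 h3) h2.symm
    simp [h1, h3, this]

theorem koszulSign_mul {n : ℕ} (d : Fin n → ℤ) (σ τ : Equiv.Perm (Fin n)) :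
    koszulSign d (σ * τ) = koszulSign d σ * koszulSign (fun t => d (σ t)) τ := by
  have e : koszulSign d σ = ∏ p ∈ Finset.univ.filter (fun p : Fin n × Fin n => p.1 < p.2),
      if (τ p.1 < τ p.2 ↔ σ (τ p.1) < σ (τ p.2)) then 1 else
        (-1 : ℤ) ^ ((d (σ (τ p.1))).natAbs * (d (σ (τ p.2))).natAbs) := by
    rw [koszulSign_eq]
    symm
    refine koszul_prod_pairs (fun i j => if (i < j ↔ σ i < σ j) then 1 else
        (-1 : ℤ) ^ ((d (σ i)).natAbs * (d (σ j)).natAbs)) ?_ τ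
    intro i j
    rcases eq_or_ne i j with rfl | hij
    · rfl
    · have h2 : σ i ≠ σ j := fun h => hij (σ.injective h)
      have : (i < j ↔ σ i < σ j) ↔ (j < i ↔ σ j < σ i) := by
        rcases lt_or_gt_of_ne hij with h | h <;> rcases lt_or_gt_of_ne h2 with h' | h' <;>
          simp [h, h', h.not_gt, h'.not_gt]
      simp only [this, mul_comm]
  rw [e, koszulSign_eq, koszulSign_eq, ← Finset.prod_mul_distrib]
  refine Finset.prod_congr rfl ?_
  rintro ⟨a, b⟩ h
  have h1 : a < b := by simpa using h
  have hs : ∀ k : ℕ, (-1 : ℤ) ^ k * (-1) ^ k = 1 := fun k => by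
    rw [← mul_pow]; simp
  simp only [h1, true_iff, Equiv.Perm.mul_apply]
  by_cases h2 : τ a < τ b <;> by_cases h3 : σ (τ a) < σ (τ b) <;> simp [h2, h3, hs]

theorem koszulSign_sq {n : ℕ} (d : Fin n → ℤ) (σ : Equiv.Perm (Fin n)) :
    koszulSign d σ * koszulSign d σ = 1 := by
  unfold koszulSign
  rw [← Finset.prod_mul_distrib]
  refine Finset.prod_eq_one fun p _ => ?_
  rw [← mul_pow]; simp

/-- The embedding of `Fin k` into `Fin m` as the interval starting at `c`. -/
def shiftEmb {k m : ℕ} (c : ℕ) (h : c + k ≤ m) : Fin k ↪ Fin m :=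
  ⟨fun a => ⟨c + a.val, by have := a.isLt; omega⟩, fun a b hab => by
    have : c + a.val = c + b.val := congrArg Fin.val hab
    exact Fin.ext (by omega)⟩

theorem shiftEmb_val {k m : ℕ} (c : ℕ) (h : c + k ≤ m) (a : Fin k) :
    (shiftEmb c h a).val = c + a.val := rfl

theorem mem_range_shiftEmb {k m : ℕ} (c : ℕ) (h : c + k ≤ m) (x : Fin m) :
    x ∈ Set.range (shiftEmb c h) ↔ c ≤ x.val ∧ x.val < c + k := by
  constructor
  · rintro ⟨a, rfl⟩
    have := a.isLt
    rw [shiftEmb_val]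
    omega
  · rintro ⟨h1, h2⟩
    exact ⟨⟨x.val - c, by omega⟩, Fin.ext (by rw [shiftEmb_val]; simp only; omega)⟩

/-- Extend a permutation of an interval by the identity. -/
noncomputable def extPerm {k m : ℕ} (c : ℕ) (h : c + k ≤ m) (τ : Equiv.Perm (Fin k)) :
    Equiv.Perm (Fin m) := τ.viaEmbedding (shiftEmb c h)

theorem extPerm_apply {k m : ℕ} (c : ℕ) (h : c + k ≤ m) (τ : Equiv.Perm (Fin k)) (a : Fin k) :
    extPerm c h τ (shiftEmb c h a) = shiftEmb c h (τ a) :=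
  τ.viaEmbedding_apply _ a

theorem extPerm_apply_not {k m : ℕ} (c : ℕ) (h : c + k ≤ m) (τ : Equiv.Perm (Fin k)) (x : Fin m)
    (hx : ¬ (c ≤ x.val ∧ x.val < c + k)) : extPerm c h τ x = x :=
  τ.viaEmbedding_apply_of_notMem _ x (by rwa [mem_range_shiftEmb])

theorem extPerm_mem {k m : ℕ} (c : ℕ) (h : c + k ≤ m) (τ : Equiv.Perm (Fin k)) (x : Fin m)
    (hx : (c ≤ x.val ∧ x.val < c + k)) :
    c ≤ (extPerm c h τ x).val ∧ (extPerm c h τ x).val < c + k := by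
  rw [← mem_range_shiftEmb c h] at hx ⊢
  obtain ⟨a, rfl⟩ := hx
  exact ⟨τ a, (extPerm_apply c h τ a).symm⟩

theorem shiftEmb_lt {k m : ℕ} (c : ℕ) (h : c + k ≤ m) (a b : Fin k) :
    shiftEmb c h a < shiftEmb c h b ↔ a < b := by
  rw [Fin.lt_def, Fin.lt_def, shiftEmb_val, shiftEmb_val]; omega

theorem koszulSign_extPerm {k m : ℕ} (c : ℕ) (h : c + k ≤ m) (τ : Equiv.Perm (Fin k))
    (d : Fin m → ℤ) :
    koszulSign d (extPerm c h τ) = koszulSign (fun t => d (shiftEmb c h t)) τ := by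
  unfold koszulSign
  symm
  refine Finset.prod_bij (fun p _ => (shiftEmb c h p.1, shiftEmb c h p.2)) ?_ ?_ ?_ ?_
  · rintro ⟨a, b⟩ hab
    simpa [extPerm_apply, shiftEmb_lt] using hab
  · rintro ⟨a, b⟩ _ ⟨a', b'⟩ _ hab
    simpa using hab
  · rintro ⟨x, y⟩ hxy
    simp only [Finset.mem_filter, Finset.mem_univ, true_and] at hxy
    obtain ⟨h1, h2⟩ := hxy
    have hx : c ≤ x.val ∧ x.val < c + k := by
      by_contra hx
      rw [extPerm_apply_not c h τ x hx] at h2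
      by_cases hy : c ≤ y.val ∧ y.val < c + k
      · have := extPerm_mem c h τ y hy
        rw [Fin.lt_def] at h1 h2
        omega
      · rw [extPerm_apply_not c h τ y hy] at h2
        exact absurd h1 (lt_asymm h2)
    have hy : c ≤ y.val ∧ y.val < c + k := by
      by_contra hy
      rw [extPerm_apply_not c h τ y hy] at h2
      have := extPerm_mem c h τ x hx
      rw [Fin.lt_def] at h1 h2
      omega
    obtain ⟨a, rfl⟩ := (mem_range_shiftEmb c h x).2 hx
    obtain ⟨b, rfl⟩ := (mem_range_shiftEmb c h y).2 hy
    refine ⟨(a, b), ?_, rfl⟩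
    simpa [extPerm_apply, shiftEmb_lt] using And.intro h1 h2
  · rintro ⟨a, b⟩ hab
    simp only [extPerm_apply]

theorem exists_restrict {k m : ℕ} (c : ℕ) (h : c + k ≤ m) (π : Equiv.Perm (Fin m))
    (hπ : ∀ x : Fin m, c ≤ x.val ∧ x.val < c + k → c ≤ (π x).val ∧ (π x).val < c + k) :
    ∃ τ : Equiv.Perm (Fin k), ∀ a, π (shiftEmb c h a) = shiftEmb c h (τ a) := by
  have : ∀ a, ∃ b, shiftEmb c h b = π (shiftEmb c h a) := fun a =>
    (mem_range_shiftEmb c h _).2 (hπ _ ((mem_range_shiftEmb c h _).1 ⟨a, rfl⟩))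
  choose f hf using this
  have hinj : Function.Injective f := by
    intro a b hab
    apply (shiftEmb c h).injective
    apply π.injective
    rw [← hf, ← hf, hab]
  exact ⟨Equiv.ofBijective f (Finite.injective_iff_bijective.1 hinj), fun a => (hf a).symm⟩

/-- Unique factorisation of a permutation as a block-increasing one times a block-preserving one. -/
theorem block_factor {m : ℕ} (b : Fin m → ℕ) (hb : Monotone b) (ρ : Equiv.Perm (Fin m)) :
    ∃ π : Equiv.Perm (Fin m), (∀ a, b (π a) = b a) ∧
      (∀ a c, a < c → b a = b c → (ρ * π) a < (ρ * π) c) ∧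
      ∀ π' : Equiv.Perm (Fin m), (∀ a, b (π' a) = b a) →
        (∀ a c, a < c → b a = b c → (ρ * π') a < (ρ * π') c) → π' = π := by
  set f : Fin m → ℕ ×ₗ Fin m := fun a => toLex (b a, ρ a) with hf
  have finj : Function.Injective f := by
    intro a c hac
    have : (b a, ρ a) = (b c, ρ c) := toLex.injective hac
    exact ρ.injective (Prod.ext_iff.1 this).2
  have hs : Monotone (f ∘ Tuple.sort f) := Tuple.monotone_sort f
  have hbs : Monotone (b ∘ Tuple.sort f) := by
    intro a c hac
    have := hs hac
    simp only [hf, Function.comp, Prod.Lex.toLex_le_toLex] at this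
    rcases this with h | h
    · exact h.le
    · exact h.1.le
  have hbe : b ∘ Tuple.sort f = b := by
    have h1 := (Tuple.comp_sort_eq_comp_iff_monotone (f := b) (σ := Tuple.sort f)).2 hbs
    have h2 := (Tuple.comp_sort_eq_comp_iff_monotone (f := b) (σ := 1)).2 hb
    rw [h1, ← h2]; rfl
  refine ⟨Tuple.sort f, fun a => congrFun hbe a, ?_, ?_⟩
  · intro a c hac hbac
    have h1 := hs hac.le
    simp only [hf, Function.comp, Prod.Lex.toLex_le_toLex] at h1
    have e1 := congrFun hbe a
    have e2 := congrFun hbe c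
    simp only [Function.comp, hf] at e1 e2
    rcases h1 with h | h
    · omega
    · refine lt_of_le_of_ne h.2 fun h => hac.ne ?_
      exact (ρ * Tuple.sort f).injective h
  · intro π' h1 h2
    have hm : Monotone (f ∘ π') := by
      intro a c hac
      simp only [hf, Function.comp, Prod.Lex.toLex_le_toLex, h1]
      rcases (hb hac).lt_or_eq with h | h
      · exact Or.inl h
      · rcases hac.lt_or_eq with h' | h'
        · exact Or.inr ⟨h, (h2 a c h' h).le⟩
        · subst h'; exact Or.inr ⟨rfl, le_rfl⟩
    have h3 := (Tuple.comp_sort_eq_comp_iff_monotone (f := f) (σ := π')).2 hm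
    exact Equiv.ext fun a => finj (congrFun h3 a)

theorem sum_block {M J : Type*} [AddCommGroup M] [Fintype J] {m : ℕ} (b : Fin m → ℕ)
    (hb : Monotone b) (S : Finset (Equiv.Perm (Fin m)))
    (hS : ∀ σ, σ ∈ S ↔ ∀ a c, a < c → b a = b c → σ a < σ c)
    (e : J → Equiv.Perm (Fin m)) (he : Function.Injective e)
    (hr : ∀ π, (∃ j, e j = π) ↔ ∀ a, b (π a) = b a)
    (F : Equiv.Perm (Fin m) → M) :
    ∑ σ ∈ S, ∑ j : J, F (σ * e j) = ∑ ρ, F ρ := by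
  have hinv : ∀ π : Equiv.Perm (Fin m), (∀ a, b (π a) = b a) → ∀ a, b (π⁻¹ a) = b a := by
    intro π h a
    have := h (π⁻¹ a)
    have h' : π (π⁻¹ a) = a := by simp
    rw [h'] at this
    exact this.symm
  rw [← Finset.sum_product']
  refine Finset.sum_bij (fun p _ => p.1 * e p.2) (fun _ _ => Finset.mem_univ _) ?_ ?_
    (fun _ _ => rfl)
  · rintro ⟨σ, j⟩ h1 ⟨σ', j'⟩ h2 heq
    simp only [Finset.mem_product, Finset.mem_univ, and_true, hS] at h1 h2 heq
    obtain ⟨π, -, -, hu⟩ := block_factor b hb (σ * e j)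
    have e1 := hu (e j)⁻¹ (hinv _ ((hr _).1 ⟨j, rfl⟩)) (by simpa using h1)
    have e2 := hu (e j')⁻¹ (hinv _ ((hr _).1 ⟨j', rfl⟩)) (by rw [heq]; simpa using h2)
    have e3 : e j = e j' := inv_injective (e1.trans e2.symm)
    have e4 : j = j' := he e3
    subst e4
    simpa using heq
  · intro ρ _
    obtain ⟨π, h1, h2, -⟩ := block_factor b hb ρ
    obtain ⟨j, hj⟩ := (hr π⁻¹).2 (hinv _ h1)
    exact ⟨(ρ * π, j), by simpa [hS] using h2, by simp [hj]⟩

theorem permExt_lt {A : Type*} {n : ℕ} (σ : Equiv.Perm (Fin (n - 1))) (d : Fin n → A) (t : Fin n)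
    (h : t.val < n - 1) :
    permExt σ d t = d (Fin.castLE (Nat.sub_le n 1) (σ ⟨t.val, h⟩)) := by
  simp [permExt, h]

theorem permExt_not_lt {A : Type*} {n : ℕ} (σ : Equiv.Perm (Fin (n - 1))) (d : Fin n → A)
    (t : Fin n) (h : ¬ t.val < n - 1) : permExt σ d t = d t := by
  simp [permExt, h]

theorem shiftEmb_zero {n : ℕ} (h : 0 + (n - 1) ≤ n) (a : Fin (n - 1)) :
    shiftEmb 0 h a = Fin.castLE (Nat.sub_le n 1) a := Fin.ext (by rw [shiftEmb_val]; simp)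

theorem extPerm_injective {k m : ℕ} (c : ℕ) (h : c + k ≤ m) :
    Function.Injective (extPerm (k := k) c h) := by
  intro τ τ' hh
  refine Equiv.ext fun a => (shiftEmb c h).injective ?_
  rw [← extPerm_apply, ← extPerm_apply, hh]

theorem sum_beta {M : Type*} [AddCommGroup M] {n : ℕ} (h : 0 + (n - 1) ≤ n)
    (F : Equiv.Perm (Fin n) → M) :
    ∑ σ ∈ Finset.univ.filter (fun σ : Equiv.Perm (Fin n) =>
            ∀ a b : Fin n, a < b → b.val < n - 1 → σ a < σ b),
      ∑ τ : Equiv.Perm (Fin (n - 1)), F (σ * extPerm 0 h τ) = ∑ ρ, F ρ := by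
  refine sum_block (fun a => if a.val < n - 1 then 0 else 1) ?_ _ ?_ _
    (extPerm_injective 0 h) ?_ F
  · intro a b hab
    rw [Fin.le_def] at hab
    dsimp only
    split_ifs <;> omega
  · intro σ
    simp only [Finset.mem_filter, Finset.mem_univ, true_and]
    refine forall_congr' fun a => forall_congr' fun c => forall_congr' fun hac => ?_
    rw [Fin.lt_def] at hac
    have : c.val < n - 1 ↔ ((if a.val < n - 1 then 0 else 1) = if c.val < n - 1 then 0 else 1) := by
      have := c.isLt
      by_cases h1 : a.val < n - 1 <;> by_cases h2 : c.val < n - 1 <;>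
        simp only [h1, h2, if_true, if_false] <;> first | (exfalso; omega) | simp
    exact imp_congr_left this
  · intro π
    constructor
    · rintro ⟨τ, rfl⟩ a
      by_cases ha : a.val < n - 1
      · have := extPerm_mem 0 h τ a (by omega)
        rw [if_pos ha, if_pos (by omega)]
      · rw [extPerm_apply_not 0 h τ a (by omega)]
    · intro hπ
      have hπ1 : ∀ a : Fin n, (π a).val < n - 1 ↔ a.val < n - 1 := by
        intro a
        have := hπ a
        split_ifs at this <;> omega
      obtain ⟨τ, hτ⟩ := exists_restrict 0 h π (fun x hx => by
        have := hπ1 x; omega)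
      refine ⟨τ, Equiv.ext fun x => ?_⟩
      by_cases hx : x.val < n - 1
      · obtain ⟨a, rfl⟩ := (mem_range_shiftEmb 0 h x).2 (by omega)
        rw [extPerm_apply, hτ]
      · rw [extPerm_apply_not 0 h τ x (by omega)]
        have := hπ1 x
        exact Fin.ext (by omega)

theorem sum_delta {M : Type*} [AddCommGroup M] {m k l : ℕ} (i : Fin m) (hk : k = i.val)
    (hl : i.val + 1 + l = m) (h1 : 0 + k ≤ m) (h2 : i.val + 1 + l ≤ m)
    (F : Equiv.Perm (Fin m) → M) :
    ∑ σ ∈ Finset.univ.filter (fun σ : Equiv.Perm (Fin m) =>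
          (∀ a b : Fin m, a < b → b.val < i.val → σ a < σ b) ∧
          (∀ a b : Fin m, a < b → i.val + 1 ≤ a.val → σ a < σ b)),
      ∑ j : Equiv.Perm (Fin k) × Equiv.Perm (Fin l),
        F (σ * (extPerm 0 h1 j.1 * extPerm (i.val + 1) h2 j.2)) = ∑ ρ, F ρ := by
  have hA : ∀ (τ1 : Equiv.Perm (Fin k)) (τ2 : Equiv.Perm (Fin l)) (x : Fin m), x.val < i.val →
      (extPerm 0 h1 τ1 * extPerm (i.val + 1) h2 τ2) x = extPerm 0 h1 τ1 x := by
    intro τ1 τ2 x hx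
    rw [Equiv.Perm.mul_apply, extPerm_apply_not _ h2 τ2 x (by omega)]
  have hB : ∀ (τ1 : Equiv.Perm (Fin k)) (τ2 : Equiv.Perm (Fin l)) (x : Fin m), i.val < x.val →
      (extPerm 0 h1 τ1 * extPerm (i.val + 1) h2 τ2) x = extPerm (i.val + 1) h2 τ2 x := by
    intro τ1 τ2 x hx
    have := extPerm_mem _ h2 τ2 x (by have := x.isLt; omega)
    rw [Equiv.Perm.mul_apply, extPerm_apply_not _ h1 τ1 _ (by omega)]
  have hC : ∀ (τ1 : Equiv.Perm (Fin k)) (τ2 : Equiv.Perm (Fin l)) (x : Fin m), i.val = x.val →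
      (extPerm 0 h1 τ1 * extPerm (i.val + 1) h2 τ2) x = x := by
    intro τ1 τ2 x hx
    rw [Equiv.Perm.mul_apply, extPerm_apply_not _ h2 τ2 x (by omega),
      extPerm_apply_not _ h1 τ1 _ (by omega)]
  refine sum_block (fun a => if a.val < i.val then 0 else if a.val = i.val then 1 else 2) ?_ _ ?_
    (fun j : Equiv.Perm (Fin k) × Equiv.Perm (Fin l) =>
      extPerm 0 h1 j.1 * extPerm (i.val + 1) h2 j.2) ?_ ?_ F
  · intro a b hab
    rw [Fin.le_def] at hab
    dsimp only
    split_ifs <;> omega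
  · intro σ
    simp only [Finset.mem_filter, Finset.mem_univ, true_and]
    constructor
    · rintro ⟨hl, hr⟩ a c hac hbc
      have hac' := Fin.lt_def.1 hac
      by_cases h : c.val < i.val
      · exact hl a c hac h
      · refine hr a c hac ?_
        split_ifs at hbc <;> omega
    · intro hh
      constructor
      · intro a c hac hc
        have hac' := Fin.lt_def.1 hac
        exact hh a c hac (by split_ifs <;> omega)
      · intro a c hac hc
        have hac' := Fin.lt_def.1 hac
        exact hh a c hac (by split_ifs <;> omega)
  · rintro ⟨τ1, τ2⟩ ⟨τ1', τ2'⟩ hh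
    dsimp only at hh
    refine Prod.ext (extPerm_injective 0 h1 (Equiv.ext fun x => ?_))
      (extPerm_injective _ h2 (Equiv.ext fun x => ?_))
    · by_cases hx : x.val < i.val
      · rw [← hA τ1 τ2 x hx, ← hA τ1' τ2' x hx, hh]
      · rw [extPerm_apply_not _ h1 _ x (by omega), extPerm_apply_not _ h1 _ x (by omega)]
    · by_cases hx : i.val < x.val
      · rw [← hB τ1 τ2 x hx, ← hB τ1' τ2' x hx, hh]
      · rw [extPerm_apply_not _ h2 _ x (by omega), extPerm_apply_not _ h2 _ x (by omega)]
  · intro π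
    constructor
    · rintro ⟨⟨τ1, τ2⟩, rfl⟩ a
      dsimp only
      rcases lt_trichotomy a.val i.val with h | h | h
      · rw [hA _ _ _ h]
        have := extPerm_mem 0 h1 τ1 a (by omega)
        split_ifs <;> omega
      · rw [hC _ _ _ h.symm]
      · rw [hB _ _ _ h]
        have := extPerm_mem _ h2 τ2 a (by have := a.isLt; omega)
        split_ifs <;> omega
    · intro hπ
      have hπ1 : ∀ a : Fin m, (a.val < i.val → (π a).val < i.val) ∧
          (a.val = i.val → (π a).val = i.val) ∧ (i.val < a.val → i.val < (π a).val) := by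
        intro a
        have := hπ a
        split_ifs at this <;> omega
      obtain ⟨τ1, hτ1⟩ := exists_restrict 0 h1 π (fun x hx => by
        have := hπ1 x; omega)
      obtain ⟨τ2, hτ2⟩ := exists_restrict (i.val + 1) h2 π (fun x hx => by
        have := hπ1 x; have := (π x).isLt; omega)
      refine ⟨(τ1, τ2), Equiv.ext fun x => ?_⟩
      dsimp only
      rcases lt_trichotomy x.val i.val with h | h | h
      · rw [hA _ _ _ h]
        obtain ⟨a, rfl⟩ := (mem_range_shiftEmb 0 h1 x).2 (by omega)
        rw [extPerm_apply, hτ1]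
      · rw [hC _ _ _ h.symm]
        have := hπ1 x
        exact Fin.ext (by omega)
      · rw [hB _ _ _ h]
        obtain ⟨a, rfl⟩ := (mem_range_shiftEmb _ h2 x).2 (by have := x.isLt; omega)
        rw [extPerm_apply, hτ2]

/-- Let `V` be a graded vector space (with grading `𝒜`), `T = T*V` the tensor
(deconcatenation) coalgebra, `W = ∧*V` the cocommutative unshuffle coalgebra and
`P = P*V = ⊕_{n≥1} (∧^{n-1}V)⊗V` the left Perm-coalgebra, with generators
`tp n x = x_1⊗⋯⊗x_n`, `wp n x = x_1∧⋯∧x_n`, `pg n x = x_1∧⋯∧x_{n-1}⊗x_n` and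
their graded skew-symmetry relations and spanning properties, and with the canonical
retraction `ρT(x_1⊗⋯⊗x_n) = (1/(n-1)!) x_1∧⋯∧x_{n-1}⊗x_n`. Then the map
`γ̂ : P*V → T*V`, `γ̂(x_1∧⋯∧x_{n-1}⊗x_n) = Σ_{σ∈S_{n-1}} ε(σ) x_{σ(1)}⊗⋯⊗x_{σ(n-1)}⊗x_n`,
is an injective coalgebra morphism, and `γ̂ ∘ β̂ = α̂`, where
`α̂(x_1∧⋯∧x_n) = Σ_{σ∈S_n} ε(σ) x_{σ(1)}⊗⋯⊗x_{σ(n)}` and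
`β̂(x_1∧⋯∧x_n) = Σ_{σ∈Sh(n-1,1)} ε(σ) x_{σ(1)}∧⋯∧x_{σ(n-1)}⊗x_{σ(n)}`. -/
theorem gammaHat_injective_coalgebra_map_and_comp {K V T W P : Type*} [Field K] [CharZero K]
    [AddCommGroup V] [Module K V] [AddCommGroup T] [Module K T]
    [AddCommGroup W] [Module K W] [AddCommGroup P] [Module K P]
    (𝒜 : ℤ → Submodule K V)
    (tp : (n : ℕ) → (Fin n → V) → T)
    (wp : (n : ℕ) → (Fin n → V) → W)
    (pg : (n : ℕ) → (Fin n → V) → P)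
    (ΔT : T →ₗ[K] T ⊗[K] T) (ΔP : P →ₗ[K] P ⊗[K] P)
    (α : W →ₗ[K] T) (β : W →ₗ[K] P) (γ : P →ₗ[K] T) (ρT : T →ₗ[K] P)
    (hwskew : ∀ (n : ℕ) (d : Fin n → ℤ) (x : Fin n → V), (∀ i, x i ∈ 𝒜 (d i)) →
      ∀ σ : Equiv.Perm (Fin n), wp n x = koszulSign d σ • wp n (fun i => x (σ i)))
    (hpskew : ∀ (n : ℕ) (d : Fin n → ℤ) (x : Fin n → V), (∀ i, x i ∈ 𝒜 (d i)) →
      ∀ σ : Equiv.Perm (Fin (n - 1)),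
        pg n x =
          koszulSign (fun t : Fin (n - 1) => d (Fin.castLE (Nat.sub_le n 1) t)) σ •
            pg n (permExt σ x))
    (hspanW : ⊤ ≤ Submodule.span K
      {w : W | ∃ (n : ℕ) (d : Fin n → ℤ) (x : Fin n → V),
        (∀ i, x i ∈ 𝒜 (d i)) ∧ w = wp n x})
    (hspanP : ⊤ ≤ Submodule.span K
      {w : P | ∃ (n : ℕ) (d : Fin n → ℤ) (x : Fin n → V),
        (∀ i, x i ∈ 𝒜 (d i)) ∧ w = pg n x})
    (hΔT : ∀ (n : ℕ) (x : Fin n → V), ΔT (tp n x) =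
      ∑ i : Fin (n - 1),
        tp (i.val + 1) (fun t => x ⟨t.val, by have := t.isLt; have := i.isLt; omega⟩) ⊗ₜ[K]
        tp (n - i.val - 1) (fun t => x ⟨i.val + 1 + t.val, by have := t.isLt; omega⟩))
    (hΔP : ∀ (n : ℕ) (d : Fin n → ℤ) (x : Fin n → V), (∀ i, x i ∈ 𝒜 (d i)) →
      ΔP (pg n x) =
      ∑ i : Fin (n - 1), ∑ σ ∈ Finset.univ.filter (fun σ : Equiv.Perm (Fin (n - 1)) =>
          (∀ a b : Fin (n - 1), a < b → b.val < i.val → σ a < σ b) ∧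
          (∀ a b : Fin (n - 1), a < b → i.val + 1 ≤ a.val → σ a < σ b)),
        koszulSign (fun t : Fin (n - 1) => d (Fin.castLE (Nat.sub_le n 1) t)) σ •
          (pg (i.val + 1)
              (fun t => permExt σ x ⟨t.val, by have := t.isLt; have := i.isLt; omega⟩) ⊗ₜ[K]
           pg (n - i.val - 1)
              (fun t => permExt σ x ⟨i.val + 1 + t.val, by have := t.isLt; omega⟩)))
    (hα : ∀ (n : ℕ) (d : Fin n → ℤ) (x : Fin n → V), (∀ i, x i ∈ 𝒜 (d i)) →
      α (wp n x) = ∑ σ : Equiv.Perm (Fin n), koszulSign d σ • tp n (fun t => x (σ t)))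
    (hβ : ∀ (n : ℕ) (d : Fin n → ℤ) (x : Fin n → V), (∀ i, x i ∈ 𝒜 (d i)) →
      β (wp n x) =
        ∑ σ ∈ Finset.univ.filter (fun σ : Equiv.Perm (Fin n) =>
            ∀ a b : Fin n, a < b → b.val < n - 1 → σ a < σ b),
          koszulSign d σ • pg n (fun t => x (σ t)))
    (hγ : ∀ (n : ℕ) (d : Fin n → ℤ) (x : Fin n → V), (∀ i, x i ∈ 𝒜 (d i)) →
      γ (pg n x) =
        ∑ τ : Equiv.Perm (Fin (n - 1)),
          koszulSign (fun t : Fin (n - 1) => d (Fin.castLE (Nat.sub_le n 1) t)) τ •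
            tp n (permExt τ x))
    (hρT : ∀ (n : ℕ) (x : Fin n → V),
      ρT (tp n x) = (((n - 1).factorial : K)⁻¹) • pg n x) :
    (∀ q : P, TensorProduct.map γ γ (ΔP q) = ΔT (γ q))
    ∧ Function.Injective γ
    ∧ (∀ w : W, γ (β w) = α w) := by
  have hmem : ∀ (n : ℕ) (d : Fin n → ℤ) (x : Fin n → V), (∀ i, x i ∈ 𝒜 (d i)) →
      ∀ (σ : Equiv.Perm (Fin (n - 1))) (i), permExt σ x i ∈ 𝒜 (permExt σ d i) := by
    intro n d x hx σ i
    by_cases h : i.val < n - 1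
    · rw [permExt_lt _ _ _ h, permExt_lt _ _ _ h]; exact hx _
    · rw [permExt_not_lt _ _ _ h, permExt_not_lt _ _ _ h]; exact hx _
  refine ⟨?_, ?_, ?_⟩
  · have key : (TensorProduct.map γ γ) ∘ₗ ΔP = ΔT ∘ₗ γ := by
      refine LinearMap.ext_on (top_le_iff.1 hspanP) ?_
      rintro _ ⟨n, d, x, hx, rfl⟩
      rw [LinearMap.comp_apply, LinearMap.comp_apply, hΔP n d x hx, hγ n d x hx]
      simp only [map_sum, map_zsmul, hΔT, Finset.smul_sum]
      rw [Finset.sum_comm]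
      refine Finset.sum_congr rfl fun i _ => ?_
      have hi := i.isLt
      have h1 : 0 + (i.val + 1 - 1) ≤ n - 1 := by omega
      have h2 : i.val + 1 + (n - i.val - 1 - 1) ≤ n - 1 := by omega
      rw [← sum_delta i (by omega) (by omega) h1 h2]
      refine Finset.sum_congr rfl fun σ _ => ?_
      rw [TensorProduct.map_tmul,
        hγ (i.val + 1) (fun t => permExt σ d ⟨t.val, by have := t.isLt; omega⟩) _
          (fun t => hmem n d x hx σ _),
        hγ (n - i.val - 1) (fun t => permExt σ d ⟨i.val + 1 + t.val, by have := t.isLt; omega⟩) _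
          (fun t => hmem n d x hx σ _),
        TensorProduct.sum_tmul, Fintype.sum_prod_type, Finset.smul_sum]
      refine Finset.sum_congr rfl fun τ1 _ => ?_
      rw [TensorProduct.tmul_sum, Finset.smul_sum]
      refine Finset.sum_congr rfl fun τ2 _ => ?_
      have hA : ∀ a : Fin (i.val + 1 - 1),
          (extPerm 0 h1 τ1 * extPerm (i.val + 1) h2 τ2) (shiftEmb 0 h1 a)
            = shiftEmb 0 h1 (τ1 a) := by
        intro a
        have := a.isLt
        rw [Equiv.Perm.mul_apply, extPerm_apply_not _ h2 τ2 _ (by rw [shiftEmb_val]; omega),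
          extPerm_apply]
      have hB : ∀ a : Fin (n - i.val - 1 - 1),
          (extPerm 0 h1 τ1 * extPerm (i.val + 1) h2 τ2) (shiftEmb (i.val + 1) h2 a)
            = shiftEmb (i.val + 1) h2 (τ2 a) := by
        intro a
        rw [Equiv.Perm.mul_apply, extPerm_apply,
          extPerm_apply_not _ h1 τ1 _ (by rw [shiftEmb_val]; omega)]
      have hC : (extPerm 0 h1 τ1 * extPerm (i.val + 1) h2 τ2) i = i := by
        rw [Equiv.Perm.mul_apply, extPerm_apply_not _ h2 τ2 _ (by omega),
          extPerm_apply_not _ h1 τ1 _ (by omega)]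
      have hsign : koszulSign (fun t : Fin (n - 1) => d (Fin.castLE (Nat.sub_le n 1) t))
          (σ * (extPerm 0 h1 τ1 * extPerm (i.val + 1) h2 τ2)) =
          koszulSign (fun t : Fin (n - 1) => d (Fin.castLE (Nat.sub_le n 1) t)) σ *
          (koszulSign (fun t : Fin (i.val + 1 - 1) =>
            permExt σ d ⟨(Fin.castLE (Nat.sub_le (i.val + 1) 1) t).val,
              by have := t.isLt; simp only [Fin.val_castLE]; omega⟩) τ1 *
          koszulSign (fun t : Fin (n - i.val - 1 - 1) =>
            permExt σ d ⟨i.val + 1 + (Fin.castLE (Nat.sub_le (n - i.val - 1) 1) t).val,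
              by have := t.isLt; simp only [Fin.val_castLE]; omega⟩) τ2) := by
        rw [koszulSign_mul, koszulSign_mul, koszulSign_extPerm, koszulSign_extPerm]
        congr 3
        · funext t
          have := t.isLt
          rw [permExt_lt _ _ _ (by simp only [Fin.val_castLE]; omega)]
          congr 3
          exact Fin.ext (by rw [shiftEmb_val]; simp)
        · funext t
          have := t.isLt
          rw [permExt_lt _ _ _ (by simp only [Fin.val_castLE]; omega),
            extPerm_apply_not _ h1 τ1 _ (by rw [shiftEmb_val]; omega)]
          congr 3
      have hx1 : permExt τ1 (fun t : Fin (i.val + 1) =>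
            permExt σ x ⟨t.val, by have := t.isLt; omega⟩) =
          fun t : Fin (i.val + 1) =>
            permExt (σ * (extPerm 0 h1 τ1 * extPerm (i.val + 1) h2 τ2)) x
              ⟨t.val, by have := t.isLt; omega⟩ := by
        funext t
        have ht := t.isLt
        rw [permExt_lt (σ * _) x _ (show t.val < n - 1 by omega)]
        by_cases h : t.val < i.val + 1 - 1
        · rw [permExt_lt _ _ _ h, permExt_lt _ _ _ (by
            simp only [Fin.val_castLE]
            have := (τ1 ⟨t.val, h⟩).isLt
            omega)]
          have e1 : (⟨t.val, by omega⟩ : Fin (n - 1)) = shiftEmb 0 h1 ⟨t.val, h⟩ :=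
            Fin.ext (by rw [shiftEmb_val]; simp)
          rw [Equiv.Perm.mul_apply, e1, hA]
          congr 3
          exact Fin.ext (by rw [shiftEmb_val]; simp)
        · have e1 : (⟨t.val, by omega⟩ : Fin (n - 1)) = i := Fin.ext (by simp only; omega)
          rw [permExt_not_lt _ _ _ h, permExt_lt _ _ _ (show t.val < n - 1 by omega),
            Equiv.Perm.mul_apply, e1, hC]
      have hx2 : permExt τ2 (fun t : Fin (n - i.val - 1) =>
            permExt σ x ⟨i.val + 1 + t.val, by have := t.isLt; omega⟩) =
          fun t : Fin (n - i.val - 1) =>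
            permExt (σ * (extPerm 0 h1 τ1 * extPerm (i.val + 1) h2 τ2)) x
              ⟨i.val + 1 + t.val, by have := t.isLt; omega⟩ := by
        funext t
        have ht := t.isLt
        by_cases h : t.val < n - i.val - 1 - 1
        · rw [permExt_lt (σ * _) x _ (show i.val + 1 + t.val < n - 1 by omega)]
          rw [permExt_lt _ _ _ h, permExt_lt _ _ _ (by
            simp only [Fin.val_castLE]
            have := (τ2 ⟨t.val, h⟩).isLt
            omega)]
          have e1 : (⟨i.val + 1 + t.val, by omega⟩ : Fin (n - 1))
              = shiftEmb (i.val + 1) h2 ⟨t.val, h⟩ := rfl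
          rw [Equiv.Perm.mul_apply, e1, hB]
          congr 3
        · rw [permExt_not_lt _ _ _ h,
            permExt_not_lt _ _ _ (show ¬ i.val + 1 + t.val < n - 1 by omega),
            permExt_not_lt _ _ _ (show ¬ i.val + 1 + t.val < n - 1 by omega)]
      rw [hsign, hx1, hx2, mul_smul, mul_smul, TensorProduct.tmul_smul, TensorProduct.smul_tmul']
      congr 1
      rw [smul_comm, TensorProduct.smul_tmul', TensorProduct.smul_tmul']
    exact fun q => LinearMap.congr_fun key q
  · have key : ρT ∘ₗ γ = LinearMap.id := by
      refine LinearMap.ext_on (top_le_iff.1 hspanP) ?_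
      rintro _ ⟨n, d, x, hx, rfl⟩
      rw [LinearMap.comp_apply, hγ n d x hx, map_sum, LinearMap.id_apply]
      have : ∀ τ : Equiv.Perm (Fin (n - 1)),
          ρT (koszulSign (fun t : Fin (n - 1) => d (Fin.castLE (Nat.sub_le n 1) t)) τ •
            tp n (permExt τ x)) = (((n - 1).factorial : K)⁻¹) • pg n x := by
        intro τ
        rw [map_zsmul, hρT, smul_comm, ← hpskew n d x hx τ]
      rw [Finset.sum_congr rfl fun τ _ => this τ, Finset.sum_const, Finset.card_univ,
        Fintype.card_perm, Fintype.card_fin, ← Nat.cast_smul_eq_nsmul K, smul_smul,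
        mul_inv_cancel₀ (Nat.cast_ne_zero.2 (Nat.factorial_ne_zero _)), one_smul]
    exact Function.LeftInverse.injective (g := ρT) fun q => LinearMap.congr_fun key q
  · have key : γ ∘ₗ β = α := by
      refine LinearMap.ext_on (top_le_iff.1 hspanW) ?_
      rintro _ ⟨n, d, x, hx, rfl⟩
      have h0 : 0 + (n - 1) ≤ n := by omega
      rw [LinearMap.comp_apply, hβ n d x hx, hα n d x hx, map_sum, ← sum_beta h0]
      refine Finset.sum_congr rfl fun σ _ => ?_
      rw [map_zsmul, hγ n (fun t => d (σ t)) _ (fun t => hx _), Finset.smul_sum]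
      refine Finset.sum_congr rfl fun τ _ => ?_
      rw [koszulSign_mul, koszulSign_extPerm, mul_smul]
      have e1 : permExt τ (fun t => x (σ t)) = fun t => x ((σ * extPerm 0 h0 τ) t) := by
        funext t
        by_cases h : t.val < n - 1
        · have e2 : t = shiftEmb 0 h0 ⟨t.val, h⟩ := Fin.ext (by rw [shiftEmb_val]; simp)
          rw [permExt_lt _ _ _ h, Equiv.Perm.mul_apply]
          conv_rhs => rw [e2, extPerm_apply, shiftEmb_zero]
        · rw [permExt_not_lt _ _ _ h, Equiv.Perm.mul_apply, extPerm_apply_not _ h0 τ _ (by omega)]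
      rw [e1]
      simp only [shiftEmb_zero]
    exact fun q => LinearMap.congr_fun key q
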